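/- Let (R, m) be a commutative Noetherian local ring, M a finitely generated Cohen–Macaulay R-module of dimension d ≥ 1, q an ideal generated by a system of parameters on M, and c = ℓ(M/qM). If N is a Cohen–Macaulay submodule of M with dim N = d, then μ(N) ≤ c. -/

import Mathlib

open Pointwise

/-- The length `ℓ(M)` of an `R`-module `M` (possibly infinite), defined as the supremum of the
lengths of strictly increasing chains of submodules of `M`. -/
noncomputable def moduleLength (R M : Type*) [CommRing R] [AddCommGroup M] [Module R M] : ℕ∞ :=
  ⨆ s : LTSeries (Submodule R M), (s.length : ℕ∞)

/-- The depth of a module `M` over a local ring `(R, m)`: the supremum of the lengths of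
(weakly) regular sequences on `M` consisting of elements of `m`. -/
noncomputable def moduleDepth (R M : Type*) [CommRing R] [IsLocalRing R]
    [AddCommGroup M] [Module R M] : ℕ∞ :=
  sSup {n : ℕ∞ | ∃ rs : List R, (∀ r ∈ rs, r ∈ IsLocalRing.maximalIdeal R) ∧
    RingTheory.Sequence.IsWeaklyRegular M rs ∧ (rs.length : ℕ∞) = n}

/-- A finitely generated module `M` over a Noetherian local ring is Cohen–Macaulay if
`depth M = dim M`, where `dim M` is the Krull dimension of `R ⧸ Ann M`. -/
def IsCohenMacaulayModule (R M : Type*) [CommRing R] [IsLocalRing R]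
    [AddCommGroup M] [Module R M] : Prop :=
  (moduleDepth R M : WithBot ℕ∞) = ringKrullDim (R ⧸ Module.annihilator R M)

namespace Module

variable {R : Type*} [CommRing R] {A B C : Type*} [AddCommGroup A] [AddCommGroup B]
  [AddCommGroup C] [Module R A] [Module R B] [Module R C]

/-- Length is subadditive along right exact sequences. -/
lemma length_le_add_of_rightExact (f : A →ₗ[R] B) (g : B →ₗ[R] C)
    (hg : Function.Surjective g) (h : Function.Exact f g) :
    Module.length R B ≤ Module.length R A + Module.length R C := by
  rw [Module.length_eq_add_of_exact (LinearMap.range f).subtype g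
    (Submodule.subtype_injective _) hg
    (by rw [LinearMap.exact_iff, Submodule.range_subtype, h.linearMap_ker_eq])]
  gcongr
  exact Module.length_le_of_surjective f.rangeRestrict f.surjective_rangeRestrict

end Module

section PowersOfSequence

open Ideal

variable {R : Type*} [CommRing R]

lemma Ideal.ofList_cons_pow_succ (x : R) (xs : List R) (n : ℕ) :
    ofList (x :: xs) ^ (n + 1) =
      span {x} * ofList (x :: xs) ^ n ⊔ ofList xs ^ (n + 1) := by
  rw [ofList_cons]
  apply le_antisymm
  · induction n with
    | zero => simp
    | succ n ih =>
      calc (span {x} ⊔ ofList xs) ^ (n + 1 + 1)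
          = (span {x} ⊔ ofList xs) * (span {x} ⊔ ofList xs) ^ (n + 1) := pow_succ' _ _
        _ = span {x} * (span {x} ⊔ ofList xs) ^ (n + 1) ⊔
              ofList xs * (span {x} ⊔ ofList xs) ^ (n + 1) := Ideal.sup_mul _ _ _
        _ ≤ _ := by
          refine sup_le le_sup_left ?_
          refine (Ideal.mul_mono_right ih).trans ?_
          rw [Ideal.mul_sup]
          refine sup_le (le_trans ?_ le_sup_left) (le_trans ?_ le_sup_right)
          · rw [mul_left_comm]
            refine Ideal.mul_mono_right ?_
            rw [pow_succ' (span {x} ⊔ ofList xs)]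
            exact Ideal.mul_mono_left le_sup_right
          · rw [← pow_succ']
  · refine sup_le ?_ (Ideal.pow_right_mono le_sup_right _)
    rw [pow_succ']
    exact Ideal.mul_mono_left le_sup_left

variable {N : Type*} [AddCommGroup N] [Module R N]

lemma Ideal.ofList_cons_pow_succ_smul_top (x : R) (xs : List R) (n : ℕ) :
    (ofList (x :: xs) ^ (n + 1) • ⊤ : Submodule R N) =
      x • (ofList (x :: xs) ^ n • ⊤ : Submodule R N) ⊔ ofList xs ^ (n + 1) • ⊤ := by
  rw [ofList_cons_pow_succ, Submodule.sup_smul, Submodule.mul_smul,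
    Submodule.ideal_span_singleton_smul]

lemma smul_sup_le_sup_smul_top (x : R) (A B : Submodule R N) :
    x • A ⊔ B ≤ B ⊔ x • (⊤ : Submodule R N) := by
  rw [sup_comm]
  exact sup_le_sup_left (Submodule.map_mono le_top) _

/-- Multiplication by `x` as a map `N ⧸ qⁿN → N ⧸ qⁿ⁺¹N`, where `q = (x, xs)`. -/
noncomputable def powQuotientSMul (N : Type*) [AddCommGroup N] [Module R N] (x : R) (xs : List R)
    (n : ℕ) :
    (N ⧸ (ofList (x :: xs) ^ n • ⊤ : Submodule R N)) →ₗ[R]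
      (N ⧸ (ofList (x :: xs) ^ (n + 1) • ⊤ : Submodule R N)) :=
  Submodule.mapQ _ _ (LinearMap.lsmul R N x) fun u hu ↦ by
    rw [ofList_cons_pow_succ_smul_top]
    exact Submodule.mem_sup_left (Submodule.smul_mem_pointwise_smul _ _ _ hu)

/-- The projection `N ⧸ qⁿN → N' ⧸ q'ⁿN'`, where `q = (x, xs)`, `q' = (xs)` and `N' = N ⧸ xN`. -/
noncomputable def powQuotientProj (N : Type*) [AddCommGroup N] [Module R N] (x : R) (xs : List R)
    (n : ℕ) :
    (N ⧸ (ofList (x :: xs) ^ n • ⊤ : Submodule R N)) →ₗ[R]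
      (QuotSMulTop x N ⧸ (ofList xs ^ n • ⊤ : Submodule R (QuotSMulTop x N))) :=
  Submodule.mapQ _ _ (Submodule.mkQ _) <| by
    rw [Submodule.comap_smul_top_of_surjective _ _ (Submodule.mkQ_surjective _),
      Submodule.ker_mkQ]
    cases n with
    | zero => simp
    | succ n =>
      rw [ofList_cons_pow_succ_smul_top, sup_comm]
      exact sup_le_sup_left (Submodule.map_mono le_top) _

lemma powQuotientProj_surjective (x : R) (xs : List R) (n : ℕ) :
    Function.Surjective (powQuotientProj N x xs n) := by
  intro u
  obtain ⟨v, rfl⟩ := Submodule.mkQ_surjective _ u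
  obtain ⟨w, rfl⟩ := Submodule.mkQ_surjective _ v
  exact ⟨Submodule.Quotient.mk w, rfl⟩

lemma powQuotient_exact (x : R) (xs : List R) (n : ℕ) :
    Function.Exact (powQuotientSMul N x xs n) (powQuotientProj N x xs (n + 1)) := by
  intro u
  obtain ⟨u, rfl⟩ := Submodule.mkQ_surjective _ u
  have key : powQuotientProj N x xs (n + 1) (Submodule.mkQ _ u) = 0 ↔
      u ∈ (ofList xs ^ (n + 1) • ⊤ ⊔ x • ⊤ : Submodule R N) := by
    have h := Submodule.comap_smul_top_of_surjective (ofList xs ^ (n + 1))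
      (x • ⊤ : Submodule R N).mkQ (Submodule.mkQ_surjective _)
    rw [Submodule.ker_mkQ] at h
    rw [← h]
    exact Submodule.Quotient.mk_eq_zero _
  rw [key]
  constructor
  · intro h
    obtain ⟨a, ha, b, hb, rfl⟩ := Submodule.mem_sup.mp h
    obtain ⟨w, -, rfl⟩ := hb
    refine ⟨Submodule.Quotient.mk w, ?_⟩
    change Submodule.Quotient.mk (x • w) = Submodule.Quotient.mk _
    rw [Submodule.Quotient.eq, ofList_cons_pow_succ_smul_top]
    refine Submodule.mem_sup_right ?_
    simpa using ha
  · rintro ⟨w, hw⟩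
    obtain ⟨w, rfl⟩ := Submodule.mkQ_surjective _ w
    change Submodule.Quotient.mk (x • w) = Submodule.Quotient.mk _ at hw
    rw [Submodule.Quotient.eq, ofList_cons_pow_succ_smul_top] at hw
    have hmem := smul_sup_le_sup_smul_top x _ _ hw
    have hx : x • w ∈ (ofList xs ^ (n + 1) • ⊤ ⊔ x • ⊤ : Submodule R N) :=
      Submodule.mem_sup_right (Submodule.smul_mem_pointwise_smul w x ⊤ trivial)
    simpa using Submodule.sub_mem _ hx hmem

/-- The length of `N ⧸ qⁿN` is at most `ℓ(N ⧸ qN)` times the number of monomials of degree less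
than `n` in a system of generators of `q`. -/
lemma length_quotient_pow_smul_top_le (xs : List R) (n : ℕ) :
    Module.length R (N ⧸ (ofList xs ^ n • ⊤ : Submodule R N)) ≤
      Module.length R (N ⧸ (ofList xs • ⊤ : Submodule R N)) * n.multichoose xs.length := by
  induction xs generalizing N n with
  | nil =>
    cases n with
    | zero => simp [Submodule.Quotient.subsingleton_iff]
    | succ n =>
      rw [ofList_nil, Ideal.bot_pow n.succ_ne_zero]
      simp
  | cons x xs ih =>
    induction n with
    | zero => simp [Submodule.Quotient.subsingleton_iff]
    | succ n ihn =>
      have h1 := Module.length_le_add_of_rightExact _ _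
        (powQuotientProj_surjective (N := N) x xs (n + 1)) (powQuotient_exact x xs n)
      have h2 := ih (N := QuotSMulTop x N) (n + 1)
      rw [← (Submodule.quotOfListConsSMulTopEquivQuotSMulTopInner N x xs).length_eq] at h2
      refine h1.trans ((add_le_add ihn h2).trans_eq ?_)
      rw [List.length_cons, Nat.multichoose_succ_succ]
      push_cast
      ring

/-- If `x` is a nonzerodivisor modulo every power of `(xs)`, then
`(x, xs)ⁿ⁺¹N : x = (x, xs)ⁿN`. -/
lemma mem_ofList_cons_pow_smul_top_of_smul_mem {x : R} {xs : List R}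
    (h : ∀ (n : ℕ) (u : N), x • u ∈ (ofList xs ^ n • ⊤ : Submodule R N) →
      u ∈ (ofList xs ^ n • ⊤ : Submodule R N)) (n : ℕ) (u : N)
    (hu : x • u ∈ (ofList (x :: xs) ^ (n + 1) • ⊤ : Submodule R N)) :
    u ∈ (ofList (x :: xs) ^ n • ⊤ : Submodule R N) := by
  rw [ofList_cons_pow_succ_smul_top] at hu
  obtain ⟨_, ⟨b, hb, rfl⟩, a, ha, hab⟩ := Submodule.mem_sup.mp hu
  have hb : b ∈ (ofList (x :: xs) ^ n • ⊤ : Submodule R N) := hb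
  have h1 : x • (u - b) ∈ (ofList xs ^ (n + 1) • ⊤ : Submodule R N) := by
    rw [smul_sub, ← hab]
    simpa using ha
  have h2 : u - b ∈ (ofList (x :: xs) ^ n • ⊤ : Submodule R N) := by
    refine Submodule.smul_mono_left ?_ (h _ _ h1)
    rw [ofList_cons]
    exact (Ideal.pow_right_mono le_sup_right _).trans (Ideal.pow_le_pow_right n.le_succ)
  simpa using Submodule.add_mem _ h2 hb

variable [IsLocalRing R] [IsNoetherianRing R] [Module.Finite R N]

open RingTheory.Sequence IsLocalRing

/-- If `x :: xs` is weakly regular on `N`, then `x` is a nonzerodivisor on `N ⧸ (xs)ⁿN`. -/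
lemma mem_ofList_pow_smul_top_of_smul_mem {x : R} {xs : List R}
    (hm : ∀ r ∈ x :: xs, r ∈ maximalIdeal R) (h : IsWeaklyRegular N (x :: xs)) (n : ℕ) (u : N)
    (hu : x • u ∈ (ofList xs ^ n • ⊤ : Submodule R N)) :
    u ∈ (ofList xs ^ n • ⊤ : Submodule R N) := by
  induction xs generalizing N x n u with
  | nil =>
    cases n with
    | zero => simp
    | succ n =>
      rw [isWeaklyRegular_singleton_iff] at h
      simp only [ofList_nil, Ideal.bot_pow n.succ_ne_zero, Submodule.bot_smul,
        Submodule.mem_bot] at hu ⊢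
      exact h.right_eq_zero_of_smul hu
  | cons y ys ih =>
    have hx : IsWeaklyRegular N (y :: x :: ys) :=
      isWeaklyRegular_of_perm_of_subset_maximalIdeal h (List.Perm.swap _ _ _) hm
    have hy : IsWeaklyRegular N (y :: ys) := by
      have := isWeaklyRegular_of_perm_of_subset_maximalIdeal h
        (List.perm_append_singleton x (y :: ys)).symm hm
      exact ((isWeaklyRegular_append_iff _ _ _).mp this).1
    have hmx : ∀ r ∈ x :: ys, r ∈ maximalIdeal R := fun r hr ↦ hm r (by grind)
    have hmy : ∀ r ∈ y :: ys, r ∈ maximalIdeal R := fun r hr ↦ hm r (by grind)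
    induction n generalizing u with
    | zero => simp
    | succ n ihn =>
      have key : u ∈ (ofList ys ^ (n + 1) • ⊤ ⊔ y • ⊤ : Submodule R N) := by
        rw [← (y • ⊤ : Submodule R N).ker_mkQ, ← Submodule.comap_smul_top_of_surjective _ _
          (Submodule.mkQ_surjective _)]
        refine ih (N := QuotSMulTop y N) hmx ((isWeaklyRegular_cons_iff _ _ _).mp hx).2
          (n + 1) _ ?_
        rw [ofList_cons_pow_succ_smul_top] at hu
        rw [← map_smul, ← Submodule.mem_comap, Submodule.comap_smul_top_of_surjective _ _
          (Submodule.mkQ_surjective _), Submodule.ker_mkQ]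
        exact smul_sup_le_sup_smul_top y _ _ hu
      obtain ⟨a, ha, _, ⟨v, -, rfl⟩, rfl⟩ := Submodule.mem_sup.mp key
      have hle : (ofList ys ^ (n + 1) • ⊤ : Submodule R N) ≤ ofList (y :: ys) ^ (n + 1) • ⊤ := by
        rw [ofList_cons_pow_succ_smul_top]
        exact le_sup_right
      have hyv : y • x • v ∈ (ofList (y :: ys) ^ (n + 1) • ⊤ : Submodule R N) := by
        have := Submodule.sub_mem _ hu (Submodule.smul_mem _ x (hle ha))
        rw [smul_add, add_sub_cancel_left] at this
        rwa [smul_comm]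
      have hv := ihn v (mem_ofList_cons_pow_smul_top_of_smul_mem
        (fun m w ↦ ih hmy hy m w) n _ hyv)
      refine Submodule.add_mem _ (hle ha) ?_
      rw [ofList_cons_pow_succ_smul_top]
      exact Submodule.mem_sup_left (Submodule.smul_mem_pointwise_smul _ _ _ hv)

/-- Hilbert–Samuel function of a weakly regular sequence. -/
lemma length_quotient_pow_smul_top_eq {xs : List R} (hm : ∀ r ∈ xs, r ∈ maximalIdeal R)
    (h : IsWeaklyRegular N xs) (n : ℕ) :
    Module.length R (N ⧸ (ofList xs ^ (n + 1) • ⊤ : Submodule R N)) =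
      Module.length R (N ⧸ (ofList xs • ⊤ : Submodule R N)) *
        (n + 1).multichoose xs.length := by
  induction xs generalizing N n with
  | nil =>
    rw [ofList_nil, Ideal.bot_pow n.succ_ne_zero]
    simp
  | cons x xs ih =>
    induction n with
    | zero =>
      rw [zero_add, pow_one]
      simp
    | succ n ihn =>
      have hinj : Function.Injective (powQuotientSMul N x xs (n + 1)) := by
        rw [injective_iff_map_eq_zero]
        intro u hu
        obtain ⟨u, rfl⟩ := Submodule.mkQ_surjective _ u
        replace hu := (Submodule.Quotient.mk_eq_zero _).mp hu
        exact (Submodule.Quotient.mk_eq_zero _).mpr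
          (mem_ofList_cons_pow_smul_top_of_smul_mem
            (mem_ofList_pow_smul_top_of_smul_mem hm h) _ _ hu)
      have h2 := ih (N := QuotSMulTop x N) (fun r hr ↦ hm r (by grind))
        ((isWeaklyRegular_cons_iff _ _ _).mp h).2 (n + 1)
      rw [← (Submodule.quotOfListConsSMulTopEquivQuotSMulTopInner N x xs).length_eq] at h2
      rw [Module.length_eq_add_of_exact _ _ hinj
        (powQuotientProj_surjective (N := N) x xs (n + 1 + 1)) (powQuotient_exact x xs (n + 1)),
        ihn, h2, List.length_cons, Nat.multichoose_succ_succ (n + 1)]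
      push_cast
      ring

end PowersOfSequence

section Exchange

open CategoryTheory Abelian IsLocalRing RingTheory.Sequence

universe u v

/-- For a finite module `N` over a Noetherian local ring, if there is an `N`-regular sequence of
length `n + 1` in the maximal ideal and `x` is any `N`-regular element of the maximal ideal, then
there is an `N ⧸ xN`-regular sequence of length `n`. -/
lemma exists_isRegular_quotSMulTop {R : Type u} [CommRing R] [IsNoetherianRing R] [IsLocalRing R]
    {N : Type v} [AddCommGroup N] [Module R N] [Module.Finite R N] {rs : List R} {n : ℕ}
    (hlen : rs.length = n + 1) (hm : ∀ r ∈ rs, r ∈ maximalIdeal R) (hreg : IsRegular N rs)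
    {x : R} (hx : x ∈ maximalIdeal R) (hxN : IsSMulRegular N x) :
    ∃ rs' : List R, rs'.length = n ∧ (∀ r ∈ rs', r ∈ maximalIdeal R) ∧
      IsRegular (QuotSMulTop x N) rs' := by
  have := hreg.nontrivial
  let e : ULift.{u} N ≃ₗ[R] N := ULift.moduleEquiv
  have hx' : IsSMulRegular (ULift.{u} N) x := e.isSMulRegular_congr x |>.mpr hxN
  have hreg' : IsRegular (ULift.{u} N) rs := (e.isRegular_congr rs).mpr hreg
  let K : ModuleCat.{max u v} R := ModuleCat.of R (ULift.{u} N)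
  have : Module.Finite R K := Module.Finite.equiv e.symm
  have : Nontrivial K := e.toEquiv.nontrivial
  let K' : ModuleCat.{max u v} R := ModuleCat.of R (QuotSMulTop x K)
  have : Nontrivial K' := nontrivial_quotSMulTop_of_mem_maximalIdeal K hx
  have lt (L : Type (max u v)) [AddCommGroup L] [Module R L] [Module.Finite R L] [Nontrivial L] :
      maximalIdeal R • (⊤ : Submodule R L) < ⊤ :=
    (Submodule.top_ne_ideal_smul_of_le_jacobson_annihilator
      (maximalIdeal_le_jacobson _)).symm.lt_top
  have h : ∀ i < n + 1, Subsingleton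
      (Ext (ModuleCat.of R (Shrink.{max u v} (R ⧸ maximalIdeal R))) K i) := by
    have := (ModuleCat.exists_isRegular_tfae (maximalIdeal R) (n + 1) K (lt K)).out 3 1
    exact this.mp ⟨rs, hlen, hm, hreg'⟩
  have tfae := (ModuleCat.exists_isRegular_tfae (maximalIdeal R) n K' (lt K')).out 1 3
  obtain ⟨rs', hlen', hm', h'⟩ := tfae.mp <| by
      intro i hi
      have zero1 := AddCommGrpCat.isZero_of_iff_subsingleton.mpr (h i (by omega))
      have zero2 := AddCommGrpCat.isZero_of_iff_subsingleton.mpr (h (i + 1) (by omega))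
      exact AddCommGrpCat.subsingleton_of_isZero <| ShortComplex.Exact.isZero_of_both_zeros
        ((Ext.covariant_sequence_exact₃' _ hx'.smulShortComplex_shortExact) i (i + 1) rfl)
        (zero1.eq_zero_of_src _) (zero2.eq_zero_of_tgt _)
  exact ⟨rs', hlen', hm', ((QuotSMulTop.congr x e).isRegular_congr rs').mp h'⟩

end Exchange

section Dimension

open IsLocalRing RingTheory.Sequence

variable {R : Type*} [CommRing R] [IsNoetherianRing R] [IsLocalRing R]

/-- The depth of a finite module is at most the dimension of `R ⧸ p` for every associated prime
`p`. -/
lemma length_le_ringKrullDim_quotient_of_mem_associatedPrimes {N : Type*} [AddCommGroup N]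
    [Module R N] [Module.Finite R N] {rs : List R} (hm : ∀ r ∈ rs, r ∈ maximalIdeal R)
    (h : IsWeaklyRegular N rs) {p : Ideal R} (hp : p ∈ associatedPrimes R N) :
    (rs.length : WithBot ℕ∞) ≤ ringKrullDim (R ⧸ p) := by
  induction rs generalizing N p with
  | nil =>
    have := hp.isPrime
    simpa using ringKrullDim_nonneg_of_nontrivial (R := R ⧸ p)
  | cons x xs ih =>
    rw [isWeaklyRegular_cons_iff] at h
    have hpp : p.IsPrime := hp.isPrime
    have hxm : x ∈ maximalIdeal R := hm x (by simp)
    have hxp : x ∉ p := by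
      have h1 : x ∈ (⋃ p ∈ associatedPrimes R N, (p : Set R))ᶜ := by
        rw [biUnion_associatedPrimes_eq_compl_regular, compl_compl]
        exact h.1
      simp only [Set.mem_compl_iff, Set.mem_iUnion, not_exists] at h1
      exact h1 p hp
    let K : Submodule R N :=
      { carrier := {z | ∀ r ∈ p, r • z = 0}
        add_mem' := fun ha hb r hr ↦ by rw [smul_add, ha r hr, hb r hr, add_zero]
        zero_mem' := fun r _ ↦ smul_zero r
        smul_mem' := fun s z hz r hr ↦ by rw [smul_comm, hz r hr, smul_zero] }
    have hK : ¬ K ≤ x • ⊤ := by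
      intro hle
      have hKx : K ≤ maximalIdeal R • K := by
        intro z hz
        obtain ⟨w, -, rfl⟩ := hle hz
        refine Submodule.smul_mem_smul hxm fun r hr ↦ ?_
        have : x • r • w = 0 := by
          rw [smul_comm]
          exact hz r hr
        exact h.1.right_eq_zero_of_smul this
      have hbot : K = ⊥ := Submodule.eq_bot_of_le_smul_of_le_jacobson_bot _ K
        (IsNoetherian.noetherian K) hKx (maximalIdeal_le_jacobson _)
      obtain ⟨-, z, hz⟩ := isAssociatedPrime_iff.mp hp
      have hzK : z ∈ K := fun r hr ↦ by
        rw [hz] at hr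
        simpa using hr
      rw [hbot, Submodule.mem_bot] at hzK
      subst hzK
      apply hpp.ne_top
      rw [hz]
      ext
      simp
    obtain ⟨z, hzK, hz⟩ := Set.not_subset.mp hK
    have hz0 : (Submodule.Quotient.mk z : QuotSMulTop x N) ≠ 0 := by
      rwa [Ne, Submodule.Quotient.mk_eq_zero]
    obtain ⟨p', hp', hle⟩ := exists_le_isAssociatedPrime_of_isNoetherianRing R _ hz0
    have hpp' : p ≤ p' := by
      refine le_trans (fun r hr ↦ ?_) hle
      rw [Submodule.mem_colon_singleton, ← Submodule.Quotient.mk_smul, hzK r hr]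
      simp
    have hxp' : x ∈ p' := by
      refine hle ?_
      rw [Submodule.mem_colon_singleton, ← Submodule.Quotient.mk_smul, Submodule.mem_bot,
        Submodule.Quotient.mk_eq_zero]
      exact Submodule.smul_mem_pointwise_smul _ _ _ trivial
    have ih' := ih (fun r hr ↦ hm r (by simp [hr])) h.2 hp'
    have step := ringKrullDim_succ_le_of_surjective (Ideal.Quotient.factor hpp')
      (Ideal.Quotient.factor_surjective hpp') (r := Ideal.Quotient.mk p x)
      (mem_nonZeroDivisors_of_ne_zero (by rwa [Ne, Ideal.Quotient.eq_zero_iff_mem]))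
      (by simpa [Ideal.Quotient.eq_zero_iff_mem] using hxp')
    rw [List.length_cons]
    push_cast
    exact (add_le_add_left ih' 1).trans step

/-- If the only prime containing `Ann N` and the sequence `xs` is the maximal ideal, then
`dim N ≤ xs.length`. -/
lemma supportDim_le_length {N : Type*} [AddCommGroup N] [Module R N] [Module.Finite R N]
    {xs : List R} (hm : ∀ r ∈ xs, r ∈ maximalIdeal R)
    (h : ∀ P : Ideal R, P.IsPrime → Module.annihilator R N ≤ P → (∀ r ∈ xs, r ∈ P) →
      P = maximalIdeal R) :
    Module.supportDim R N ≤ xs.length := by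
  induction xs generalizing N with
  | nil =>
    rw [Module.supportDim_eq_ringKrullDim_quotient_annihilator]
    have : Ring.KrullDimLE 0 (R ⧸ Module.annihilator R N) := by
      refine Ideal.krullDimLE_zero_quotient_iff_forall_minimalPrimes_isMaximal.mpr fun J hJ ↦ ?_
      rw [h J hJ.1.1 hJ.1.2 (by simp)]
      infer_instance
    exact this.krullDim_le
  | cons x xs ih =>
    refine (Module.supportDim_le_supportDim_quotSMulTop_succ (hm x (by simp))).trans ?_
    rw [List.length_cons]
    push_cast
    refine add_le_add_left (ih (fun r hr ↦ hm r (by simp [hr])) fun P hP hann hxs ↦ ?_) 1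
    refine h P hP ((LinearMap.annihilator_le_of_surjective _
      (Submodule.mkQ_surjective (x • ⊤ : Submodule R N))).trans hann) ?_
    simpa using ⟨hann (QuotSMulTop.mem_annihilator N x), hxs⟩

/-- Let `N` be a finite module over a Noetherian local ring with a regular sequence of length `n`
in the maximal ideal. Then any `n` elements of the maximal ideal which together with `Ann N`
generate an ideal primary to the maximal ideal form a weakly regular sequence on `N`. -/
lemma isWeaklyRegular_of_forall_prime_eq {N : Type*} [AddCommGroup N] [Module R N]
    [Module.Finite R N] {xs rs : List R} (hm : ∀ r ∈ xs, r ∈ maximalIdeal R)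
    (h : ∀ P : Ideal R, P.IsPrime → Module.annihilator R N ≤ P → (∀ r ∈ xs, r ∈ P) →
      P = maximalIdeal R)
    (hlen : rs.length = xs.length) (hrm : ∀ r ∈ rs, r ∈ maximalIdeal R) (hrs : IsRegular N rs) :
    IsWeaklyRegular N xs := by
  induction xs generalizing N rs with
  | nil => exact IsWeaklyRegular.nil R N
  | cons x xs ih =>
    have hxs : ∀ r ∈ xs, r ∈ maximalIdeal R := fun r hr ↦ hm r (by simp [hr])
    have hx : IsSMulRegular N x := by
      have h1 : x ∈ (⋃ p ∈ associatedPrimes R N, (p : Set R))ᶜ := by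
        simp only [Set.mem_compl_iff, Set.mem_iUnion, not_exists]
        intro p hp hxp
        have hpann : Module.annihilator R N ≤ p :=
          Submodule.annihilator_top (R := R) (M := N) ▸ hp.annihilator_le
        have h2 := length_le_ringKrullDim_quotient_of_mem_associatedPrimes hrm
          hrs.toIsWeaklyRegular hp
        have h3 := supportDim_le_length (N := R ⧸ p) hxs fun P hP hann hPxs ↦ by
          rw [Ideal.annihilator_quotient] at hann
          exact h P hP (hpann.trans hann) (by simpa using ⟨hann hxp, hPxs⟩)
        rw [Module.supportDim_quotient_eq_ringKrullDim] at h3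
        have h4 := h2.trans h3
        rw [hlen, List.length_cons] at h4
        norm_cast at h4
        omega
      rwa [biUnion_associatedPrimes_eq_compl_regular, compl_compl] at h1
    obtain ⟨rs', hlen', hrm', hrs'⟩ := exists_isRegular_quotSMulTop hlen hrm hrs
      (hm x (by simp)) hx
    refine .cons hx (ih hxs (fun P hP hann hPxs ↦ h P hP ?_ ?_) hlen' hrm' hrs')
    · exact (LinearMap.annihilator_le_of_surjective _
        (Submodule.mkQ_surjective (x • ⊤ : Submodule R N))).trans hann
    · simpa using ⟨hann (QuotSMulTop.mem_annihilator N x), hPxs⟩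

end Dimension

lemma moduleLength_eq_length (R M : Type*) [CommRing R] [AddCommGroup M] [Module R M] :
    moduleLength R M = Module.length R M := by
  apply WithBot.coe_injective
  rw [Module.coe_length, Order.krullDim_eq_iSup_length, moduleLength]

lemma exists_isWeaklyRegular_of_moduleDepth_eq {R N : Type*} [CommRing R] [IsLocalRing R]
    [AddCommGroup N] [Module R N] {d : ℕ} (h : moduleDepth R N = d) :
    ∃ rs : List R, rs.length = d ∧ (∀ r ∈ rs, r ∈ IsLocalRing.maximalIdeal R) ∧
      RingTheory.Sequence.IsWeaklyRegular N rs := by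
  rw [moduleDepth] at h
  set S := {n : ℕ∞ | ∃ rs : List R, (∀ r ∈ rs, r ∈ IsLocalRing.maximalIdeal R) ∧
    RingTheory.Sequence.IsWeaklyRegular N rs ∧ (rs.length : ℕ∞) = n}
  have : Nonempty S := ⟨0, [], by simp, .nil R N, by simp⟩
  obtain ⟨rs, hm, hrs, hlen⟩ := ENat.sSup_mem_of_nonempty_of_lt_top (h ▸ ENat.natCast_lt_top d)
  rw [h] at hlen
  exact ⟨rs, by exact_mod_cast hlen, hm, hrs⟩

section FiniteLength

open IsLocalRing

variable {R : Type*} [CommRing R] [IsLocalRing R]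

lemma IsLocalRing.exists_maximalIdeal_pow_le_annihilator (K : Type*) [AddCommGroup K] [Module R K]
    [IsArtinian R K] [IsNoetherian R K] :
    ∃ k, maximalIdeal R ^ k ≤ Module.annihilator R K := by
  obtain ⟨k, hk⟩ := IsArtinian.monotone_stabilizes (R := R) (M := K)
    ⟨fun n ↦ OrderDual.toDual (maximalIdeal R ^ n • (⊤ : Submodule R K)),
      fun i j hij ↦ Submodule.smul_mono_left (Ideal.pow_le_pow_right hij)⟩
  have h : maximalIdeal R ^ k • (⊤ : Submodule R K) = maximalIdeal R ^ (k + 1) • ⊤ :=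
    hk (k + 1) k.le_succ
  have hbot : maximalIdeal R ^ k • (⊤ : Submodule R K) = ⊥ := by
    refine Submodule.eq_bot_of_le_smul_of_le_jacobson_bot (maximalIdeal R) _
      (IsNoetherian.noetherian _) ?_ (maximalIdeal_le_jacobson _)
    rw [← Submodule.mul_smul, ← pow_succ', ← h]
  refine ⟨k, ?_⟩
  rw [← Submodule.annihilator_top, Submodule.le_annihilator_iff, hbot]

lemma IsLocalRing.eq_maximalIdeal_of_length_quotient_ne_top {M : Type*} [AddCommGroup M]
    [Module R M] [Module.Finite R M] {q : Ideal R}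
    (hq : Module.length R (M ⧸ (q • ⊤ : Submodule R M)) ≠ ⊤) {P : Ideal R} (hP : P.IsPrime)
    (hann : Module.annihilator R M ≤ P) (hqP : q ≤ P) : P = maximalIdeal R := by
  have hfin := Module.length_ne_top_iff.mp hq
  obtain ⟨_, _⟩ := isFiniteLength_iff_isNoetherian_isArtinian.mp hfin
  obtain ⟨k, hk⟩ := IsLocalRing.exists_maximalIdeal_pow_le_annihilator (R := R)
    (M ⧸ (q • ⊤ : Submodule R M))
  have hsupp : (⟨P, hP⟩ : PrimeSpectrum R) ∈
      Module.support R (M ⧸ (q • ⊤ : Submodule R M)) := by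
    rw [Module.support_quotient, Module.support_eq_zeroLocus]
    exact ⟨hann, hqP⟩
  rw [Module.support_eq_zeroLocus] at hsupp
  exact le_antisymm (le_maximalIdeal hP.ne_top) (hP.le_of_pow_le (hk.trans hsupp))

end FiniteLength

section Comparison

open Ideal

variable {R : Type*} [CommRing R] {M : Type*} [AddCommGroup M] [Module R M]

lemma Ideal.exists_comap_pow_smul_top_le [IsNoetherianRing R] [Module.Finite R M] (q : Ideal R)
    (N : Submodule R M) :
    ∃ k, ∀ n, (q ^ (n + k) • ⊤ : Submodule R M).comap N.subtype ≤ q ^ n • ⊤ := by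
  obtain ⟨k, hk⟩ := Ideal.exists_pow_inf_eq_pow_smul q N
  refine ⟨k, fun n ↦ ?_⟩
  rw [← Submodule.map_le_map_iff_of_injective N.subtype_injective, Submodule.map_comap_subtype,
    Submodule.map_smul'', Submodule.map_subtype_top, inf_comm, hk _ (Nat.le_add_left k n),
    Nat.add_sub_cancel]
  exact Submodule.smul_mono le_rfl inf_le_right

lemma Submodule.length_quotient_le_of_comap_le {N : Submodule R M} {A : Submodule R M}
    {B : Submodule R N} (h : A.comap N.subtype ≤ B) :
    Module.length R (N ⧸ B) ≤ Module.length R (M ⧸ A) := by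
  refine (Module.length_le_of_surjective (Submodule.factor h)
    (Submodule.factor_surjective h)).trans ?_
  refine Module.length_le_of_injective (Submodule.mapQ _ A N.subtype le_rfl) ?_
  rw [← LinearMap.ker_eq_bot]
  exact Submodule.ker_liftQ_eq_bot _ _ _ (by rw [LinearMap.ker_comp, Submodule.ker_mkQ])

end Comparison

open Filter Topology in
/-- Comparison of leading coefficients of two polynomially growing functions. -/
lemma Nat.le_of_forall_mul_multichoose_le {a c d k : ℕ}
    (h : ∀ n, a * (n + 1).multichoose d ≤ c * (n + 1 + k).multichoose d) : a ≤ c := by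
  have hbound (n : ℕ) : (a : ℝ) ≤ c * (((k + d : ℝ) + 1 * n) / (1 + 1 * n)) ^ d := by
    have h1 : ((n + 1 : ℝ)) ^ d / d.factorial ≤ ((n + 1).multichoose d : ℝ) := by
      have := Nat.pow_le_choose (α := ℝ) d (n + d)
      rw [show n + d + 1 - d = n + 1 by omega] at this
      rw [Nat.multichoose_eq, show n + 1 + d - 1 = n + d by omega]
      exact_mod_cast this
    have h2 : ((n + 1 + k).multichoose d : ℝ) ≤ (n + k + d : ℝ) ^ d / d.factorial := by
      have := Nat.choose_le_pow_div (α := ℝ) d (n + k + d)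
      rw [Nat.multichoose_eq, show n + 1 + k + d - 1 = n + k + d by omega]
      exact_mod_cast this
    have h3 : (a : ℝ) * (n + 1).multichoose d ≤ c * (n + 1 + k).multichoose d := by
      exact_mod_cast h n
    have hd : (0 : ℝ) < d.factorial := by positivity
    have h4 : (a : ℝ) * ((n + 1 : ℝ) ^ d / d.factorial) ≤
        c * ((n + k + d : ℝ) ^ d / d.factorial) := by
      calc _ ≤ (a : ℝ) * (n + 1).multichoose d := by gcongr
        _ ≤ c * (n + 1 + k).multichoose d := h3
        _ ≤ _ := by gcongr
    rw [← mul_div_assoc, ← mul_div_assoc, div_le_div_iff_of_pos_right hd] at h4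
    rw [div_pow, ← mul_div_assoc, le_div_iff₀ (by positivity)]
    convert h4 using 3 <;> ring
  have hlim : Tendsto (fun n : ℕ ↦ (c : ℝ) * (((k + d : ℝ) + 1 * n) / (1 + 1 * n)) ^ d) atTop
      (𝓝 (c * (1 / 1) ^ d)) :=
    ((tendsto_add_mul_div_add_mul_atTop_nhds _ _ _ one_ne_zero).pow d).const_mul _
  have := ge_of_tendsto' hlim hbound
  simpa using this

/-- The minimal number of generators is at most the length of `N ⧸ qN` for any `q ≤ m`. -/
lemma IsLocalRing.spanFinrank_le_length_quotient {R : Type*} [CommRing R] [IsLocalRing R]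
    {M : Type*} [AddCommGroup M] [Module R M] {N : Submodule R M} (hN : N.FG) {q : Ideal R}
    (hq : q ≤ maximalIdeal R) :
    (N.spanFinrank : ℕ∞) ≤ Module.length R (N ⧸ (q • ⊤ : Submodule R N)) := by
  have hle : (q • ⊤ : Submodule R N) ≤ maximalIdeal R • ⊤ := Submodule.smul_mono_left hq
  refine le_trans ?_ (Module.length_le_of_surjective (Submodule.factor hle)
    (Submodule.factor_surjective hle))
  have : Module.Finite R N := Module.Finite.iff_fg.mpr hN
  let := Ideal.Quotient.field (maximalIdeal R)
  have : Module.Finite (R ⧸ maximalIdeal R) (N ⧸ maximalIdeal R • (⊤ : Submodule R N)) :=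
    Module.Finite.of_restrictScalars_finite R _ _
  rw [IsLocalRing.spanFinrank_eq_finrank_quotient N hN, ← Module.length_eq_finrank,
    Module.length_eq_of_surjective (R := R ⧸ maximalIdeal R) Ideal.Quotient.mk_surjective]

/-- **Corollary 5 (first part).** Let `(R, m)` be a commutative Noetherian local ring, `M` a
finitely generated Cohen–Macaulay `R`-module of dimension `d ≥ 1`, `q` an ideal generated by a
system of parameters on `M`, and `c = ℓ(M/qM)`.  If `N` is a Cohen–Macaulay submodule of `M`
with `dim N = d`, then `μ(N) ≤ c`. -/
theorem generators_bound_of_cohenMacaulay_submodule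
    {R : Type*} [CommRing R] [IsNoetherianRing R] [IsLocalRing R]
    (M : Type*) [AddCommGroup M] [Module R M] [Module.Finite R M]
    (d : ℕ) (hd : 1 ≤ d)
    (hdim : ringKrullDim (R ⧸ Module.annihilator R M) = d)
    (hCM : IsCohenMacaulayModule R M)
    (q : Ideal R) (f : Fin d → R) (hfm : ∀ i, f i ∈ IsLocalRing.maximalIdeal R)
    (hq : q = Ideal.span (Set.range f))
    (c : ℕ) (hc : moduleLength R (M ⧸ (q • ⊤ : Submodule R M)) = c)
    (N : Submodule R M)
    (hCMN : IsCohenMacaulayModule R N)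
    (hdimN : ringKrullDim (R ⧸ Module.annihilator R N) = d) :
    ∃ s : Finset M, s.card ≤ c ∧ Submodule.span R (s : Set M) = N := by
  have hfin : Module.length R (M ⧸ (q • ⊤ : Submodule R M)) = c := by
    rw [← moduleLength_eq_length, hc]
  obtain rfl : q = Ideal.ofList (List.ofFn f) := by
    rw [hq, Ideal.ofList]
    congr 1
    ext
    simp
  have hlen : (List.ofFn f).length = d := List.length_ofFn
  have hfm' : ∀ r ∈ List.ofFn f, r ∈ IsLocalRing.maximalIdeal R := by
    simpa [List.mem_ofFn] using hfm
  have hqm : Ideal.ofList (List.ofFn f) ≤ IsLocalRing.maximalIdeal R := Ideal.span_le.mpr hfm'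
  obtain ⟨rs, hrs, hrm, hreg⟩ := exists_isWeaklyRegular_of_moduleDepth_eq (R := R) (N := N) (d := d)
    (by rw [IsCohenMacaulayModule, hdimN] at hCMN; exact_mod_cast hCMN)
  have : Nontrivial N := by
    by_contra hN
    rw [not_nontrivial_iff_subsingleton] at hN
    rw [← Module.supportDim_eq_ringKrullDim_quotient_annihilator,
      Module.supportDim_eq_bot_of_subsingleton] at hdimN
    exact WithBot.bot_ne_coe hdimN
  have hregf : RingTheory.Sequence.IsWeaklyRegular N (List.ofFn f) := by
    refine isWeaklyRegular_of_forall_prime_eq hfm' (fun P hP hann hPf ↦ ?_)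
      (hrs.trans hlen.symm) hrm
      (RingTheory.Sequence.IsRegular.of_isWeaklyRegular_of_mem_maximalIdeal N hrm hreg)
    exact IsLocalRing.eq_maximalIdeal_of_length_quotient_ne_top (hfin ▸ ENat.natCast_ne_top c) hP
      ((LinearMap.annihilator_le_of_injective N.subtype N.subtype_injective).trans hann)
      (Ideal.span_le.mpr hPf)
  obtain ⟨k, hk⟩ := Ideal.exists_comap_pow_smul_top_le (Ideal.ofList (List.ofFn f)) N
  have key (n : ℕ) :
      Module.length R (N ⧸ (Ideal.ofList (List.ofFn f) • ⊤ : Submodule R N)) *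
        (n + 1).multichoose d ≤ c * (n + 1 + k).multichoose d := by
    have h1 := Submodule.length_quotient_le_of_comap_le (hk (n + 1))
    rw [length_quotient_pow_smul_top_eq hfm' hregf n] at h1
    have h2 := h1.trans (length_quotient_pow_smul_top_le (N := M) (List.ofFn f) (n + 1 + k))
    rwa [hfin, hlen] at h2
  have hne : Module.length R (N ⧸ (Ideal.ofList (List.ofFn f) • ⊤ : Submodule R N)) ≠ ⊤ := by
    intro htop
    have h1 := key 0
    rw [htop, zero_add, Nat.multichoose_one] at h1
    simp at h1
    exact absurd h1 (by exact_mod_cast ENat.natCast_ne_top (c * (1 + k).multichoose d))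
  obtain ⟨a, ha⟩ := ENat.ne_top_iff_exists.mp hne
  have hac : a ≤ c := by
    refine Nat.le_of_forall_mul_multichoose_le (d := d) (k := k) fun n ↦ ?_
    have h1 := key n
    rw [← ha] at h1
    exact_mod_cast h1
  have hNfg : N.FG := IsNoetherian.noetherian N
  obtain ⟨s, hs, hspan⟩ := Submodule.FG.exists_span_finset_card_eq_spanFinrank hNfg
  refine ⟨s, hs.trans_le (le_trans ?_ hac), hspan⟩
  have := IsLocalRing.spanFinrank_le_length_quotient hNfg hqm
  rw [← ha] at this
  exact_mod_cast this
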